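/- For all quaternions q, r ∈ ℍ one has the equivariance identity π(q·r) = r̃·π(q)·r. Moreover, if r ∈ S³ (i.e. |r| = 1) and q ∈ S² (i.e. |q| = 1 and the i-component of q is 0), then r̃·q·r ∈ S²; thus right multiplication by r on S³ translates via the Hopf fibration to a rotation of S². -/

import Mathlib

noncomputable section

/-- The ℝ-linear involution of ℍ fixing 1, j, k and sending i to −i. -/
def Iinv (q : Quaternion ℝ) : Quaternion ℝ := ⟨q.re, -q.imI, q.imJ, q.imK⟩

/-- The Hopf map π(q) = q̃ · q. -/
def hopfMap (q : Quaternion ℝ) : Quaternion ℝ := Iinv q * q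

@[simp]
theorem re_Iinv (q : Quaternion ℝ) : (Iinv q).re = q.re := rfl

@[simp]
theorem imI_Iinv (q : Quaternion ℝ) : (Iinv q).imI = -q.imI := rfl

@[simp]
theorem imJ_Iinv (q : Quaternion ℝ) : (Iinv q).imJ = q.imJ := rfl

@[simp]
theorem imK_Iinv (q : Quaternion ℝ) : (Iinv q).imK = q.imK := rfl

theorem Iinv_mul (q r : Quaternion ℝ) : Iinv (q * r) = Iinv r * Iinv q := by
  ext <;> simp <;> ring

theorem norm_Iinv (q : Quaternion ℝ) : ‖Iinv q‖ = ‖q‖ := by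
  rw [← sq_eq_sq₀ (norm_nonneg _) (norm_nonneg _), sq, sq,
    ← Quaternion.normSq_eq_norm_mul_self, ← Quaternion.normSq_eq_norm_mul_self]
  simp [Quaternion.normSq_def']

theorem imI_Iinv_mul_mul {q : Quaternion ℝ} (r : Quaternion ℝ) (hq : q.imI = 0) :
    (Iinv r * q * r).imI = 0 := by
  simp [hq]
  ring

/-- Equivariance of the Hopf map: π(q·r) = r̃·π(q)·r, and for r ∈ S³ the map
q ↦ r̃·q·r preserves S² ⊂ S³. -/
theorem hopfMap_equivariant :
    (∀ q r : Quaternion ℝ, hopfMap (q * r) = Iinv r * hopfMap q * r) ∧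
    (∀ q r : Quaternion ℝ, ‖r‖ = 1 → ‖q‖ = 1 → q.imI = 0 →
      ‖Iinv r * q * r‖ = 1 ∧ (Iinv r * q * r).imI = 0) := by
  refine ⟨fun q r => ?_, fun q r hr hq hi => ⟨?_, imI_Iinv_mul_mul r hi⟩⟩
  · simp only [hopfMap, Iinv_mul, mul_assoc]
  · simp only [norm_mul, norm_Iinv, hr, hq, mul_one]
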